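/- Let λ ∈ 𝔽_q with λ ≠ 0 and n ≥ 2. Then N_q(λ) = ((q−1)^n − (−1)^n)/q + (−1)^n/(q−1) + ((−1)^n/(q(q−1))) · ∑_{k=1}^{q−2} G_q(k)^{n+1} G_q(−(n+1)k) ω(−λ)^{−(n+1)k}. -/

import Mathlib

open Finset

/-- A character of a finite cyclic group whose order is the order of the group is faithful. -/
theorem MonoidHom.injective_of_orderOf_eq_card {A M : Type*} [CommGroup A] [Finite A] [IsCyclic A]
    [CommGroup M] (ω : A →* M) (hω : orderOf ω = Nat.card A) : Function.Injective ω := by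
  obtain ⟨g, hg⟩ := IsCyclic.exists_generator (α := A)
  have horder : orderOf g ∣ orderOf (ω g) := by
    rw [orderOf_eq_card_of_forall_mem_zpowers hg, ← hω, orderOf_dvd_iff_pow_eq_one]
    ext a
    obtain ⟨i, rfl⟩ := Subgroup.mem_zpowers_iff.mp (hg a)
    rw [MonoidHom.pow_apply, map_zpow, ← zpow_natCast, zpow_comm, zpow_natCast, pow_orderOf_eq_one,
      one_zpow, MonoidHom.one_apply]
  rw [injective_iff_map_eq_one]
  intro a ha
  obtain ⟨i, rfl⟩ := Subgroup.mem_zpowers_iff.mp (hg a)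
  rw [map_zpow, ← orderOf_dvd_iff_zpow_eq_one] at ha
  exact orderOf_dvd_iff_zpow_eq_one.mp ((Int.natCast_dvd_natCast.mpr horder).trans ha)

/-- Orthogonality of the powers of a faithful character. -/
theorem sum_range_card_pow_of_injective {A K : Type*} [CommGroup A] [Fintype A] [DecidableEq A]
    [Field K] {ω : A →* Kˣ} (hω : Function.Injective ω) (a : A) :
    ∑ k ∈ range (Fintype.card A), (ω a : K) ^ k = if a = 1 then (Fintype.card A : K) else 0 := by
  split_ifs with ha
  · simp [ha]
  · have hne : (ω a : K) ≠ 1 := by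
      rw [Ne, Units.val_eq_one]
      exact fun h => ha ((injective_iff_map_eq_one ω).mp hω a h)
    rw [geom_sum_eq hne, ← Units.val_pow_eq_pow_val, ← map_pow, pow_card_eq_one]
    simp

/-- The sum of `h x₁ ⋯ h xₙ₊₁` over tuples with product `1`, in terms of the Fourier
coefficients of `h`. -/
theorem card_mul_sum_prod_mul_inv {A K : Type*} [CommGroup A] [Fintype A] [DecidableEq A]
    [Field K] {ω : A →* Kˣ} (hω : Function.Injective ω) (h : A → K) (n : ℕ) :
    (Fintype.card A : K) * ∑ x : Fin n → A, (∏ i, h (x i)) * h (∏ i, x i)⁻¹ =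
      ∑ k ∈ range (Fintype.card A), (∑ a, (ω a : K) ^ (-(k : ℤ)) * h a) ^ (n + 1) := by
  have hterm (k : ℕ) (x : Fin n → A) (z : A) :
      (∏ i, ((ω (x i) : K) ^ (-(k : ℤ)) * h (x i))) * ((ω z : K) ^ (-(k : ℤ)) * h z) =
        (∏ i, h (x i)) * h z * (ω ((∏ i, x i) * z)⁻¹ : K) ^ k := by
    rw [prod_mul_distrib, prod_zpow]
    simp only [map_inv, map_mul, map_prod, Units.val_inv_eq_inv_val, Units.val_mul,
      Units.coe_prod, zpow_neg, zpow_natCast, inv_pow, mul_pow, mul_inv]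
    ring
  have hk (k : ℕ) : (∑ a, (ω a : K) ^ (-(k : ℤ)) * h a) ^ (n + 1) =
      ∑ x : Fin n → A, ∑ z, (∏ i, h (x i)) * h z * (ω ((∏ i, x i) * z)⁻¹ : K) ^ k := by
    rw [pow_succ, Fintype.sum_pow, sum_mul_sum]
    simp only [hterm]
  simp only [hk]
  rw [sum_comm, mul_sum]
  refine sum_congr rfl fun x _ => ?_
  rw [sum_comm]
  simp only [← mul_sum, sum_range_card_pow_of_injective hω, inv_eq_one, mul_eq_one_iff_inv_eq]
  simp [mul_comm]

theorem AddChar.map_sum_eq_prod {ι A M : Type*} [AddCommMonoid A] [CommMonoid M] (ψ : AddChar A M)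
    (s : Finset ι) (f : ι → A) : ψ (∑ i ∈ s, f i) = ∏ i ∈ s, ψ (f i) :=
  map_prod ψ.toMonoidHom (fun i => Multiplicative.ofAdd (f i)) s

theorem sum_eq_zero_add_sum_units {F M : Type*} [Field F] [Fintype F] [DecidableEq F] [AddCommMonoid M]
    (f : F → M) : ∑ t, f t = f 0 + ∑ t : Fˣ, f t := by
  rw [Fintype.sum_eq_add_sum_subtype_ne f 0]
  congr 1
  exact (Fintype.sum_equiv unitsEquivNeZero _ _ fun _ => rfl).symm

/-- The number of points of `x₁ + ⋯ + xₙ + 1 / (x₁ ⋯ xₙ) = l` on the torus, in terms of the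
Gauss sums of the powers of a faithful multiplicative character. -/
theorem card_mul_card_dwork_eq {F : Type*} [Field F] [Fintype F] [DecidableEq F]
    {ω : Fˣ →* ℂˣ} (hω : Function.Injective ω) {ψ : AddChar F ℂ} (hψ : ψ ≠ 1) (n : ℕ) (l : Fˣ) :
    (Fintype.card F : ℂ) *
        Nat.card {x : Fin n → Fˣ // (∑ i, (x i : F)) + (∏ i, (x i : F))⁻¹ = l} =
      (Fintype.card Fˣ : ℂ) ^ n + (Fintype.card Fˣ : ℂ)⁻¹ * ∑ k ∈ range (Fintype.card Fˣ),
        (∑ a : Fˣ, (ω a : ℂ) ^ (-(k : ℤ)) * ψ a) ^ (n + 1) *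
          ((∑ a : Fˣ, (ω a : ℂ) ^ (((n : ℤ) + 1) * k) * ψ a) *
            (ω (-l) : ℂ) ^ (-((n : ℤ) + 1) * k)) := by
  have hdetect (x : F) : ∑ t, ψ (t * x) = if x = 0 then (Fintype.card F : ℂ) else 0 := by
    exact_mod_cast AddChar.sum_mulShift x (AddChar.IsPrimitive.of_ne_one hψ)
  have hcard : (Fintype.card F : ℂ) *
      Nat.card {x : Fin n → Fˣ // (∑ i, (x i : F)) + (∏ i, (x i : F))⁻¹ = l} =
      ∑ t, ∑ x : Fin n → Fˣ, ψ (t * ((∑ i, (x i : F)) + (∏ i, (x i : F))⁻¹ - l)) := by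
    rw [sum_comm]
    simp only [hdetect, sub_eq_zero]
    rw [← sum_filter, sum_const, Nat.card_eq_fintype_card, Fintype.card_subtype, nsmul_eq_mul,
      mul_comm]
  have hsplit (t : Fˣ) (x : Fin n → Fˣ) :
      ψ (t * ((∑ i, (x i : F)) + (∏ i, (x i : F))⁻¹ - l)) =
        ψ ((-l * t : Fˣ) : F) * ((∏ i, ψ ((t * x i : Fˣ) : F)) *
          ψ ((t * (∏ i, x i)⁻¹ : Fˣ) : F)) := by
    rw [← AddChar.map_sum_eq_prod, ← AddChar.map_add_eq_mul, ← AddChar.map_add_eq_mul]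
    congr 1
    push_cast
    rw [← mul_sum]
    ring
  have hne : (Fintype.card Fˣ : ℂ) ≠ 0 := Nat.cast_ne_zero.mpr Fintype.card_ne_zero
  have htwist (t : Fˣ) (k : ℕ) : ∑ a : Fˣ, (ω a : ℂ) ^ (-(k : ℤ)) * ψ ((t * a : Fˣ) : F) =
      (ω t : ℂ) ^ (k : ℤ) * ∑ a : Fˣ, (ω a : ℂ) ^ (-(k : ℤ)) * ψ a := by
    rw [mul_sum]
    refine Fintype.sum_equiv (Equiv.mulLeft t) _ _ fun a => ?_
    rw [Equiv.coe_mulLeft, map_mul, Units.val_mul (ω t), mul_zpow, zpow_neg (ω t : ℂ)]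
    field_simp
  have hlast (m : ℤ) : ∑ t : Fˣ, ψ ((-l * t : Fˣ) : F) * (ω t : ℂ) ^ m =
      (∑ a : Fˣ, (ω a : ℂ) ^ m * ψ a) * (ω (-l) : ℂ) ^ (-m) := by
    rw [sum_mul]
    refine Fintype.sum_equiv (Equiv.mulLeft (-l)) _ _ fun a => ?_
    rw [Equiv.coe_mulLeft, map_mul, Units.val_mul (ω (-l)), mul_zpow, zpow_neg]
    field_simp
  rw [hcard, sum_eq_zero_add_sum_units]
  congr 1
  · simp
  · simp only [hsplit, ← mul_sum]
    rw [eq_inv_mul_iff_mul_eq₀ hne, mul_sum]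
    have ht (t : Fˣ) : (Fintype.card Fˣ : ℂ) * (ψ ((-l * t : Fˣ) : F) * ∑ x : Fin n → Fˣ,
        (∏ i, ψ ((t * x i : Fˣ) : F)) * ψ ((t * (∏ i, x i)⁻¹ : Fˣ) : F)) =
        ∑ k ∈ range (Fintype.card Fˣ), (∑ a : Fˣ, (ω a : ℂ) ^ (-(k : ℤ)) * ψ a) ^ (n + 1) *
          (ψ ((-l * t : Fˣ) : F) * (ω t : ℂ) ^ (((n : ℤ) + 1) * k)) := by
      rw [mul_left_comm, card_mul_sum_prod_mul_inv hω (fun a => ψ ((t * a : Fˣ) : F)), mul_sum]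
      refine sum_congr rfl fun k _ => ?_
      rw [htwist, mul_pow, ← zpow_natCast ((ω t : ℂ) ^ (k : ℤ)), ← zpow_mul, mul_comm (k : ℤ)]
      push_cast
      ring
    simp only [ht]
    rw [sum_comm]
    refine sum_congr rfl fun k _ => ?_
    rw [neg_mul, ← hlast, mul_sum]

/-- The canonical additive character of a finite field is a nontrivial additive character. -/
theorem exists_addChar_eq_exp_trace {p : ℕ} (hp : p.Prime) {F : Type*} [Field F] [Finite F]
    [Algebra (ZMod p) F] : ∃ χ : AddChar F ℂ, χ ≠ 1 ∧ ∀ a, χ a =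
      Complex.exp (2 * Real.pi * Complex.I * ((Algebra.trace (ZMod p) F a).val : ℂ) / p) := by
  have : Fact p.Prime := ⟨hp⟩
  refine ⟨(ZMod.stdAddChar (N := p)).compAddMonoidHom
    (Algebra.trace (ZMod p) F).toAddMonoidHom, ?_, fun a => ?_⟩
  · obtain ⟨a, ha⟩ := Algebra.trace_surjective (ZMod p) F 1
    intro h
    have h1 : ZMod.stdAddChar (1 : ZMod p) = ZMod.stdAddChar (0 : ZMod p) := by
      have := DFunLike.congr_fun h a
      simpa [ha] using this
    exact one_ne_zero (ZMod.injective_stdAddChar h1)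
  · simp [ZMod.stdAddChar_apply, ZMod.toCircle_apply]

theorem dwork_family_point_count_gauss_sums_single_sum
    (p : ℕ) (hp : p.Prime) (F : Type) [Field F] [Fintype F] [DecidableEq F]
    [Algebra (ZMod p) F]
    (q : ℕ) (hq : Fintype.card F = q)
    -- ω : a multiplicative character of 𝔽_q^* of order q − 1
    (ω : Fˣ →* ℂˣ) (hω : orderOf ω = q - 1)
    -- ψ : the canonical additive character a ↦ exp(2πi·Tr(a)/p)
    (ψ : F → ℂ)
    (hψ : ∀ a : F, ψ a =
      Complex.exp (2 * Real.pi * Complex.I * ((Algebra.trace (ZMod p) F a).val : ℂ) / p))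
    -- the Gauss sums G_q(k)
    (G : ℤ → ℂ)
    (hG : ∀ k : ℤ, G k = -∑ a : Fˣ, ((ω a : ℂ) ^ (-k)) * ψ (a : F))
    (n : ℕ) (hn : 2 ≤ n)
    (lam : F) (hlam : lam ≠ 0)
    -- N : the number of points (x₁,…,xₙ) ∈ (𝔽_q^*)^n with ∑ xᵢ + 1/∏ xᵢ = λ
    (N : ℕ)
    (hN : N = Nat.card {x : Fin n → Fˣ //
        (∑ i, (x i : F)) + (∏ i, (x i : F))⁻¹ = lam}) :
    (N : ℂ) = (((q : ℂ) - 1) ^ n - (-1) ^ n) / q + (-1) ^ n / ((q : ℂ) - 1)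
      + (-1) ^ n / ((q : ℂ) * ((q : ℂ) - 1)) *
        ∑ k ∈ Finset.Icc 1 (q - 2),
          G k ^ (n + 1) * G (-((n : ℤ) + 1) * k) *
            ((ω (Units.mk0 (-lam) (neg_ne_zero.mpr hlam)) : ℂ)) ^ (-((n : ℤ) + 1) * k) := by
  obtain ⟨χ, hχ1, hχ⟩ := exists_addChar_eq_exp_trace hp (F := F)
  obtain rfl : ψ = χ := funext fun a => (hψ a).trans (hχ a).symm
  have hq2 : 2 ≤ q := hq ▸ Fintype.one_lt_card
  have hcardU : Fintype.card Fˣ = q - 1 := by rw [Fintype.card_units, hq]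
  have hinj : Function.Injective ω :=
    ω.injective_of_orderOf_eq_card (by rw [hω, Nat.card_eq_fintype_card, hcardU])
  have hl : -Units.mk0 lam hlam = Units.mk0 (-lam) (neg_ne_zero.mpr hlam) := by
    ext
    simp
  have hmain := card_mul_card_dwork_eq hinj hχ1 n (Units.mk0 lam hlam)
  have hsum0 : ∑ a : Fˣ, χ (a : F) = -1 := by
    have h := AddChar.sum_eq_zero_of_ne_one hχ1
    rw [sum_eq_zero_add_sum_units, AddChar.map_zero_eq_one] at h
    exact eq_neg_of_add_eq_zero_right h
  have hGauss (k : ℤ) : ∑ a : Fˣ, (ω a : ℂ) ^ (-k) * χ a = -G k := by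
    rw [hG, neg_neg]
  have hGauss' (k : ℕ) : ∑ a : Fˣ, (ω a : ℂ) ^ (((n : ℤ) + 1) * k) * χ a =
      -G (-((n : ℤ) + 1) * k) := by
    rw [← hGauss, neg_mul, neg_neg]
  have hG0 : G 0 = 1 := by
    simp [hG, hsum0]
  have hrange : range (q - 1) = insert 0 (Icc 1 (q - 2)) := by
    ext k
    simp only [mem_range, mem_insert, mem_Icc]
    omega
  have hqne : (q : ℂ) ≠ 0 := Nat.cast_ne_zero.mpr (by omega)
  have hq1 : (q : ℂ) - 1 ≠ 0 := sub_ne_zero.mpr (by exact_mod_cast (by omega : q ≠ 1))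
  rw [Units.val_mk0, ← hN, hq, hl, hcardU, Nat.cast_sub (by omega), Nat.cast_one, hrange,
    sum_insert (by simp)] at hmain
  simp only [hGauss, hGauss', Nat.cast_zero, mul_zero, zpow_zero, hG0, one_mul, mul_one, hsum0] at hmain
  have hsum : ∑ k ∈ Icc 1 (q - 2), (-G k) ^ (n + 1) * (-G (-((n : ℤ) + 1) * k) *
      (ω (Units.mk0 (-lam) (neg_ne_zero.mpr hlam)) : ℂ) ^ (-((n : ℤ) + 1) * k)) =
      (-1) ^ n * ∑ k ∈ Icc 1 (q - 2), G k ^ (n + 1) * G (-((n : ℤ) + 1) * k) *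
        (ω (Units.mk0 (-lam) (neg_ne_zero.mpr hlam)) : ℂ) ^ (-((n : ℤ) + 1) * k) := by
    rw [mul_sum]
    refine sum_congr rfl fun k _ => ?_
    rw [neg_pow (G k)]
    ring
  rw [hsum] at hmain
  apply mul_left_cancel₀ hqne
  rw [hmain]
  field_simp
  ring
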